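/- arXiv:2601.16039 — 6 statements merged into one kernel-verified Lean document; each statement's English description precedes it below -/
import Mathlib

section
/- Let t₁, t₂ be positive integers, let V be a type, and let G₁ = (V, E₁) and G₂ = (V, E₂) be two graphs on the same vertex set V. Let G = (V, E₁ ∪ E₂) be their union. If G₁ does not contain K_{t₁,t₁} as a subgraph and G₂ does not contain K_{t₂,t₂} as a subgraph, then G does not contain K_{t₁+t₂−1, 2^{t₁+t₂−1}·max(t₁,t₂)} as a subgraph. -/
/-- A graph `G` on vertex set `V` contains `K_{s,t}` as a subgraph if there are
disjoint subsets `A`, `B` of `V` with `|A| = s`, `|B| = t` such that every vertex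
of `A` is adjacent to every vertex of `B`. -/
def ContainsBiclique {V : Type*} (G : SimpleGraph V) (s t : ℕ) : Prop :=
  ∃ A B : Finset V, Disjoint A B ∧ A.card = s ∧ B.card = t ∧
    ∀ a ∈ A, ∀ b ∈ B, G.Adj a b

/-- Larger complete bipartite families yield bicliques of every smaller size. -/
theorem containsBiclique_of_le_card {V : Type*} {G : SimpleGraph V} {s t : ℕ} {A B : Finset V}
    (hs : s ≤ A.card) (ht : t ≤ B.card) (hAB : Disjoint A B)
    (hadj : ∀ a ∈ A, ∀ b ∈ B, G.Adj a b) : ContainsBiclique G s t := by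
  obtain ⟨A', hA', hcardA⟩ := Finset.exists_subset_card_eq hs
  obtain ⟨B', hB', hcardB⟩ := Finset.exists_subset_card_eq ht
  exact ⟨A', B', hAB.mono hA' hB', hcardA, hcardB,
    fun a ha b hb => hadj a (hA' ha) b (hB' hb)⟩

theorem stmt0 (t₁ t₂ : ℕ) (ht₁ : 0 < t₁) (ht₂ : 0 < t₂) (V : Type*)
    (G₁ G₂ : SimpleGraph V)
    (h₁ : ¬ ContainsBiclique G₁ t₁ t₁) (h₂ : ¬ ContainsBiclique G₂ t₂ t₂) :
    ¬ ContainsBiclique (G₁ ⊔ G₂) (t₁ + t₂ - 1) (2 ^ (t₁ + t₂ - 1) * max t₁ t₂) := by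
  classical
  rintro ⟨A, B, hAB, hA, hB, hadj⟩
  -- Pigeonhole on the trace in `A` of the `G₁`-neighbourhood of a vertex of `B`.
  obtain ⟨S, hS, hcard⟩ := Finset.exists_le_card_fiber_of_mul_le_card_of_maps_to
    (s := B) (t := A.powerset) (f := fun b => {a ∈ A | G₁.Adj a b}) (n := max t₁ t₂)
    (fun b _ => Finset.mem_powerset.2 (Finset.filter_subset _ _))
    ⟨∅, Finset.empty_mem_powerset A⟩ (by rw [Finset.card_powerset, hA, hB])
  rw [Finset.mem_powerset] at hS
  set C := {b ∈ B | {a ∈ A | G₁.Adj a b} = S}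
  have hmem : ∀ b ∈ C, ∀ a ∈ A, a ∈ S ↔ G₁.Adj a b := by
    intro b hb a ha
    rw [← (Finset.mem_filter.1 hb).2, Finset.mem_filter]
    exact and_iff_right ha
  have hAC : Disjoint A C := hAB.mono_right (Finset.filter_subset _ _)
  have hsum := Finset.card_sdiff_add_card_eq_card hS
  rcases le_or_gt t₁ S.card with h | h
  · exact h₁ (containsBiclique_of_le_card h ((le_max_left _ _).trans hcard) (hAC.mono_left hS)
      fun a ha b hb => (hmem b hb a (hS ha)).1 ha)
  · refine h₂ (containsBiclique_of_le_card (A := A \ S) (by omega)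
      ((le_max_right _ _).trans hcard) (hAC.mono_left Finset.sdiff_subset) fun a ha b hb => ?_)
    obtain ⟨haA, haS⟩ := Finset.mem_sdiff.1 ha
    exact (hadj a haA b (Finset.mem_filter.1 hb).1).resolve_left fun hab =>
      haS ((hmem b hb a haA).2 hab)
end

section
/- For all positive integers k and t there exists a positive integer s with the following property: for every type V and all graphs G₁, …, G_k on the common vertex set V, if no G_i contains K_{t,t} as a subgraph, then the union graph G (whose edges are the pairs adjacent in at least one G_i) does not contain K_{s,s} as a subgraph. -/
/-- Bipartite Ramsey theorem: if every pair in `A × B` satisfies one of `k` relations and `A`, `B`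
are large, then one of the relations holds on all of `S × T` for some `t`-subsets `S`, `T`. -/
theorem exists_monochromatic_product {α β : Type*} {k t : ℕ} (hk : 0 < k)
    (r : Fin k → α → β → Prop) {A : Finset α} {B : Finset β} (hA : k * t ≤ A.card)
    (hB : k * (k * t).choose t * t ≤ B.card) (h : ∀ a ∈ A, ∀ b ∈ B, ∃ i, r i a b) :
    ∃ i, ∃ S ⊆ A, ∃ T ⊆ B, S.card = t ∧ T.card = t ∧ ∀ a ∈ S, ∀ b ∈ T, r i a b := by
  classical
  have : Nonempty (Fin k) := ⟨⟨0, hk⟩⟩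
  obtain ⟨A', hA', hcard⟩ := Finset.exists_subset_card_eq hA
  have key : ∀ b, ∃ p : Fin k × Finset α, b ∈ B →
      p ∈ Finset.univ ×ˢ A'.powersetCard t ∧ ∀ a ∈ p.2, r p.1 a b := by
    intro b
    by_cases hb : b ∈ B
    · have hcol : ∀ a, ∃ i, a ∈ A' → r i a b := fun a => by
        by_cases ha : a ∈ A'
        · obtain ⟨i, hi⟩ := h a (hA' ha) b hb
          exact ⟨i, fun _ => hi⟩
        · exact ⟨⟨0, hk⟩, fun ha' => absurd ha' ha⟩
      choose c hc using hcol
      obtain ⟨i, -, hi⟩ := Finset.exists_le_card_fiber_of_mul_le_card_of_maps_to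
        (s := A') (t := Finset.univ) (f := c) (n := t) (fun _ _ => Finset.mem_univ _)
        Finset.univ_nonempty (by simp [hcard])
      obtain ⟨S, hS, hSt⟩ := Finset.exists_subset_card_eq hi
      refine ⟨(i, S), fun _ => ⟨?_, fun a ha => ?_⟩⟩
      · simpa [Finset.mem_powersetCard, hSt] using hS.trans (Finset.filter_subset _ _)
      · obtain ⟨haA, rfl⟩ := Finset.mem_filter.1 (hS ha)
        exact hc a haA
    · exact ⟨(⟨0, hk⟩, ∅), fun hb' => absurd hb' hb⟩
  choose f hf using key
  obtain ⟨⟨i, S⟩, hp, hfib⟩ := Finset.exists_le_card_fiber_of_mul_le_card_of_maps_to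
    (s := B) (t := Finset.univ ×ˢ A'.powersetCard t) (f := f) (n := t) (fun b hb => (hf b hb).1)
    (Finset.univ_nonempty.product (Finset.powersetCard_nonempty.2
      (hcard ▸ Nat.le_mul_of_pos_left t hk)))
    (by simpa [Finset.card_product, Finset.card_powersetCard, hcard] using hB)
  obtain ⟨T, hT, hTt⟩ := Finset.exists_subset_card_eq hfib
  obtain ⟨hSA, hSt⟩ := Finset.mem_powersetCard.1 (Finset.mem_product.1 hp).2
  refine ⟨i, S, hSA.trans hA', T, hT.trans (Finset.filter_subset _ _), hSt, hTt,
    fun a ha b hb => ?_⟩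
  obtain ⟨hbB, hfb⟩ := Finset.mem_filter.1 (hT hb)
  have := (hf b hbB).2
  rw [hfb] at this
  exact this a ha

theorem stmt1 (k t : ℕ) (hk : 0 < k) (ht : 0 < t) :
    ∃ s : ℕ, 0 < s ∧ ∀ (V : Type*) (G : Fin k → SimpleGraph V),
      (∀ i, ¬ ContainsBiclique (G i) t t) →
      ¬ ContainsBiclique (⨆ i, G i) s s := by
  have hpos : 0 < (k * t).choose t := Nat.choose_pos (Nat.le_mul_of_pos_left t hk)
  refine ⟨k * (k * t).choose t * t, by positivity, ?_⟩
  rintro V G hG ⟨A, B, hdisj, hA, hB, hadj⟩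
  obtain ⟨i, S, hS, T, hT, hSt, hTt, h⟩ := exists_monochromatic_product (t := t) hk
    (fun i => (G i).Adj) (A := A) (B := B)
    (hA ▸ Nat.mul_le_mul_right t (Nat.le_mul_of_pos_right k hpos)) hB.ge
    (fun a ha b hb => by simpa using hadj a ha b hb)
  exact hG i ⟨S, T, Finset.disjoint_of_subset_left hS (Finset.disjoint_of_subset_right hT hdisj),
    hSt, hTt, h⟩
end

section
/- For all positive integers k, ℓ₁, ℓ₂, m₁, m₂ there exist positive integers n₁, n₂ such that: for every coloring c assigning to each pair of tuples (ā, b̄), where ā is an ℓ₁-tuple of elements of Fin n₁ and b̄ is an ℓ₂-tuple of elements of Fin n₂, a color in Fin k, there exist subsets I₁ ⊆ Fin n₁ with |I₁| = m₁ and I₂ ⊆ Fin n₂ with |I₂| = m₂ such that for all tuples ā, ā' with all entries in I₁ and all tuples b̄, b̄' with all entries in I₂, if otp(ā) = otp(ā') and otp(b̄) = otp(b̄') then c(ā, b̄) = c(ā', b̄'). -/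
/-- Finite Ramsey theorem for `r`-element subsets of a linear order. -/
theorem exists_ramsey (κ : Type) [Finite κ] [Nonempty κ] (r : ℕ) :
    ∀ m : ℕ, ∃ N : ℕ, ∀ (α : Type) [LinearOrder α] (S : Finset α), N ≤ S.card →
      ∀ f : Finset α → κ, ∃ T ⊆ S, T.card = m ∧ ∃ k, ∀ A ⊆ T, A.card = r → f A = k := by
  classical
  have := Fintype.ofFinite κ
  induction r with
  | zero =>
    intro m
    refine ⟨m, fun α _ S hS f => ?_⟩
    obtain ⟨T, hTS, hT⟩ := Finset.exists_subset_card_eq hS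
    refine ⟨T, hTS, hT, f ∅, fun A _ hA => ?_⟩
    rw [Finset.card_eq_zero.mp hA]
  | succ r ih =>
    have endHomogeneous : ∀ t : ℕ, ∃ N : ℕ, ∀ (α : Type) [LinearOrder α] (S : Finset α),
        N ≤ S.card → ∀ f : Finset α → κ, ∃ T ⊆ S, T.card = t ∧ ∃ g : α → κ,
          ∀ x ∈ T, ∀ A ⊆ T, A.card = r → (∀ y ∈ A, x < y) → f (insert x A) = g x := by
      intro t
      induction t with
      | zero =>
        refine ⟨0, fun α _ S _ f => ⟨∅, by simp, rfl, fun _ => Classical.arbitrary κ, ?_⟩⟩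
        simp
      | succ t iht =>
        obtain ⟨N, hN⟩ := iht
        obtain ⟨N', hN'⟩ := ih N
        refine ⟨N' + 1, fun α _ S hS f => ?_⟩
        have hne : S.Nonempty := Finset.card_pos.mp (by omega)
        have hx := S.min'_mem hne
        have hmin : ∀ y ∈ S.erase (S.min' hne), S.min' hne < y := fun y hy =>
          S.min'_lt_of_mem_erase_min' hne hy
        generalize S.min' hne = x at hx hmin
        obtain ⟨T', hT'S, hT'c, k, hk⟩ := hN' α (S.erase x)
          (by rw [Finset.card_erase_of_mem hx]; omega) (fun A => f (insert x A))
        obtain ⟨T, hTT', hTc, g, hg⟩ := hN α T' hT'c.ge f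
        have hxT : ∀ y ∈ T, x < y := fun y hy => hmin y (hT'S (hTT' hy))
        have hx' : x ∉ T := fun h => lt_irrefl _ (hxT x h)
        refine ⟨insert x T, ?_, by rw [Finset.card_insert_of_notMem hx', hTc],
          Function.update g x k, ?_⟩
        · exact Finset.insert_subset hx
            ((hTT'.trans hT'S).trans (Finset.erase_subset _ _))
        · intro y hy A hA hAc hlt
          have hxA : x ∉ A := by
            intro h
            rcases Finset.mem_insert.mp hy with rfl | hy
            · exact lt_irrefl _ (hlt _ h)
            · exact lt_asymm (hlt _ h) (hxT y hy)
          have hAT : A ⊆ T := (Finset.subset_insert_iff_of_notMem hxA).mp hA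
          rcases Finset.mem_insert.mp hy with rfl | hy
          · rw [Function.update_self]
            exact hk A (hAT.trans hTT') hAc
          · rw [Function.update_of_ne (hxT y hy).ne']
            exact hg y hy A hAT hAc hlt
    intro m
    obtain ⟨N, hN⟩ := endHomogeneous (Fintype.card κ * m)
    refine ⟨N, fun α _ S hS f => ?_⟩
    obtain ⟨T, hTS, hTc, g, hg⟩ := hN α S hS f
    obtain ⟨k, -, hk⟩ := Finset.exists_le_card_fiber_of_mul_le_card_of_maps_to
      (s := T) (t := Finset.univ) (f := g) (n := m) (by simp)
      Finset.univ_nonempty (by rw [hTc, Finset.card_univ])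
    obtain ⟨U, hU, hUc⟩ := Finset.exists_subset_card_eq hk
    have hUT : U ⊆ T := hU.trans (Finset.filter_subset _ _)
    refine ⟨U, hUT.trans hTS, hUc, k, fun A hA hAc => ?_⟩
    have hne : A.Nonempty := Finset.card_pos.mp (by omega)
    have hx := A.min'_mem hne
    have hmin : ∀ y ∈ A.erase (A.min' hne), A.min' hne < y := fun y hy =>
      A.min'_lt_of_mem_erase_min' hne hy
    generalize A.min' hne = x at hx hmin
    have h := hg x (hUT (hA hx)) (A.erase x)
      ((Finset.erase_subset _ _).trans (hA.trans hUT))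
      (by rw [Finset.card_erase_of_mem hx]; omega) hmin
    rw [Finset.insert_erase hx] at h
    rw [h, (Finset.mem_filter.mp (hU (hA hx))).2]

theorem Finset.card_image_le_of_factorsThrough {ι α β : Type*} [DecidableEq α] [DecidableEq β]
    (s : Finset ι) (a : ι → α) (b : ι → β) (h : Function.FactorsThrough b a) :
    (s.image b).card ≤ (s.image a).card := by
  rcases s.eq_empty_or_nonempty with rfl | ⟨i, -⟩
  · simp
  · have : s.image b = (s.image a).image (Function.extend a b fun _ => b i) := by
      rw [Finset.image_image]
      exact Finset.image_congr fun j _ => (h.extend_apply _ j).symm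
    rw [this]
    exact Finset.card_image_le

theorem Finset.card_filter_lt_orderEmbOfFin {α : Type*} [LinearOrder α] (s : Finset α) {n : ℕ}
    (h : s.card = n) (q : Fin n) : (s.filter (· < s.orderEmbOfFin h q)).card = q := by
  have : s.filter (· < s.orderEmbOfFin h q) =
      (Finset.Iio q).map (s.orderEmbOfFin h).toEmbedding := by
    ext x
    simp only [Finset.mem_filter, Finset.mem_map, Finset.mem_Iio]
    constructor
    · rintro ⟨hx, hlt⟩
      rw [← Finset.mem_coe, ← s.range_orderEmbOfFin h] at hx
      obtain ⟨p, rfl⟩ := hx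
      exact ⟨p, (s.orderEmbOfFin h).lt_iff_lt.mp hlt, rfl⟩
    · rintro ⟨p, hp, rfl⟩
      exact ⟨s.orderEmbOfFin_mem h p, (s.orderEmbOfFin h).lt_iff_lt.mpr hp⟩
  rw [this, Finset.card_map, Fin.card_Iio]

theorem Finset.exists_lower_subset_card_eq {α : Type*} [LinearOrder α] (T : Finset α) {m : ℕ}
    (h : m ≤ T.card) : ∃ I ⊆ T, I.card = m ∧ ∀ x ∈ I, ∀ y ∈ T \ I, x < y := by
  induction m with
  | zero => exact ⟨∅, by simp, rfl, by simp⟩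
  | succ m ih =>
    obtain ⟨I, hI, hIc, hlt⟩ := ih (by omega)
    have hne : (T \ I).Nonempty := Finset.card_pos.mp (by
      rw [Finset.card_sdiff_of_subset hI]; omega)
    have hz := (T \ I).min'_mem hne
    have hmin : ∀ y ∈ T \ I, (T \ I).min' hne ≤ y := fun y hy => (T \ I).min'_le y hy
    generalize (T \ I).min' hne = z at hz hmin
    obtain ⟨hzT, hzI⟩ := Finset.mem_sdiff.mp hz
    refine ⟨insert z I, Finset.insert_subset hzT hI,
      by rw [Finset.card_insert_of_notMem hzI, hIc], ?_⟩
    intro x hx y hy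
    simp only [Finset.mem_sdiff, Finset.mem_insert, not_or] at hy
    have hy' : y ∈ T \ I := Finset.mem_sdiff.mpr ⟨hy.1, hy.2.2⟩
    rcases Finset.mem_insert.mp hx with rfl | hx
    · exact lt_of_le_of_ne (hmin y hy') (Ne.symm hy.2.1)
    · exact hlt x hx y hy'

/-- A tuple with entries in `I` factors through the increasing enumeration of an `ℓ`-element set
obtained by padding its image with elements of `J` lying above `I`; the index of each entry is its
rank among the entries of the tuple. -/
theorem exists_orderEmbOfFin_comp {α : Type*} [LinearOrder α] {ℓ : ℕ} {I J : Finset α}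
    (hJ : ℓ ≤ J.card) (hlt : ∀ x ∈ I, ∀ y ∈ J, x < y) (a : Fin ℓ → α) (ha : ∀ i, a i ∈ I) :
    ∃ (s : Finset α) (h : s.card = ℓ) (p : Fin ℓ → Fin ℓ), s ⊆ I ∪ J ∧
      a = s.orderEmbOfFin h ∘ p ∧
      ∀ i, (p i : ℕ) = ((Finset.univ.filter (fun j => a j < a i)).image a).card := by
  have hAc : (Finset.univ.image a).card ≤ ℓ := Finset.card_image_le.trans (by simp)
  have hAI : Finset.univ.image a ⊆ I := by
    intro x hx
    obtain ⟨i, -, rfl⟩ := Finset.mem_image.mp hx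
    exact ha i
  obtain ⟨B, hBJ, hBc⟩ := Finset.exists_subset_card_eq
    (s := J) (n := ℓ - (Finset.univ.image a).card) (by omega)
  have hdisj : Disjoint (Finset.univ.image a) B :=
    Finset.disjoint_left.mpr fun x hx hxB => lt_irrefl x (hlt x (hAI hx) x (hBJ hxB))
  have hs : (Finset.univ.image a ∪ B).card = ℓ := by
    rw [Finset.card_union_of_disjoint hdisj]; omega
  have hex : ∀ i, ∃ q, (Finset.univ.image a ∪ B).orderEmbOfFin hs q = a i := by
    intro i
    have : a i ∈ ((Finset.univ.image a ∪ B : Finset α) : Set α) := by simp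
    rwa [← Finset.range_orderEmbOfFin _ hs] at this
  choose p hp using hex
  refine ⟨_, hs, p, Finset.union_subset_union hAI hBJ, funext fun i => (hp i).symm, fun i => ?_⟩
  rw [← Finset.card_filter_lt_orderEmbOfFin _ hs (p i), hp i]
  congr 1
  ext x
  simp only [Finset.mem_filter, Finset.mem_union, Finset.mem_image, Finset.mem_univ, true_and]
  constructor
  · rintro ⟨⟨j, rfl⟩ | hx, hxi⟩
    · exact ⟨j, hxi, rfl⟩
    · exact absurd hxi (hlt _ (ha i) x (hBJ hx)).not_gt
  · rintro ⟨j, hj, rfl⟩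
    exact ⟨Or.inl ⟨j, rfl⟩, hj⟩

/-- Ramsey theorem for colorings of tuples, with homogeneity on each order type. -/
theorem exists_ramsey_orderType (κ : Type) [Finite κ] [Nonempty κ] (ℓ m : ℕ) :
    ∃ n : ℕ, 0 < n ∧ ∀ c : (Fin ℓ → Fin n) → κ, ∃ I : Finset (Fin n), I.card = m ∧
      ∀ a a' : Fin ℓ → Fin n, (∀ s, a s ∈ I) → (∀ s, a' s ∈ I) →
        (∀ s u, cmp (a s) (a u) = cmp (a' s) (a' u)) → c a = c a' := by
  classical
  obtain ⟨N, hN⟩ := exists_ramsey ((Fin ℓ → Fin ℓ) → κ) ℓ (m + ℓ)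
  refine ⟨N + 1, N.succ_pos, fun c => ?_⟩
  obtain ⟨T, -, hTc, k, hk⟩ := hN (Fin (N + 1)) Finset.univ (by simp) fun s p =>
    if h : s.card = ℓ then c (s.orderEmbOfFin h ∘ p) else Classical.arbitrary κ
  obtain ⟨I, hIT, hIc, hlt⟩ := T.exists_lower_subset_card_eq (m := m) (by omega)
  refine ⟨I, hIc, fun a a' ha ha' hcmp => ?_⟩
  have hJ : ℓ ≤ (T \ I).card := by rw [Finset.card_sdiff_of_subset hIT]; omega
  obtain ⟨s, hs, p, hsT, hap, hp⟩ := exists_orderEmbOfFin_comp hJ hlt a ha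
  obtain ⟨s', hs', p', hsT', hap', hp'⟩ := exists_orderEmbOfFin_comp hJ hlt a' ha'
  rw [Finset.union_sdiff_of_subset hIT] at hsT hsT'
  have hpp : p = p' := by
    funext i
    apply Fin.ext
    rw [hp, hp']
    have hfilter : Finset.univ.filter (fun j => a j < a i) =
        Finset.univ.filter (fun j => a' j < a' i) := by
      ext j
      simp only [Finset.mem_filter, Finset.mem_univ, true_and]
      rw [← cmp_eq_lt_iff, ← cmp_eq_lt_iff, hcmp]
    have heq : ∀ j u, a j = a u ↔ a' j = a' u := fun j u => by
      rw [← cmp_eq_eq_iff (a j) (a u), hcmp, cmp_eq_eq_iff]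
    rw [hfilter]
    exact le_antisymm
      (Finset.card_image_le_of_factorsThrough _ _ _ fun j u h => (heq j u).mpr h)
      (Finset.card_image_le_of_factorsThrough _ _ _ fun j u h => (heq j u).mp h)
  have h := congrFun (hk s hsT hs) p
  have h' := congrFun (hk s' hsT' hs') p'
  simp only [hs, hs', dite_true] at h h'
  rw [hap, hap', h, h', hpp]

theorem stmt2 (k ℓ₁ ℓ₂ m₁ m₂ : ℕ) (hk : 0 < k) (hℓ₁ : 0 < ℓ₁) (hℓ₂ : 0 < ℓ₂)
    (hm₁ : 0 < m₁) (hm₂ : 0 < m₂) :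
    ∃ n₁ n₂ : ℕ, 0 < n₁ ∧ 0 < n₂ ∧
      ∀ c : (Fin ℓ₁ → Fin n₁) → (Fin ℓ₂ → Fin n₂) → Fin k,
        ∃ (I₁ : Finset (Fin n₁)) (I₂ : Finset (Fin n₂)),
          I₁.card = m₁ ∧ I₂.card = m₂ ∧
          ∀ (a a' : Fin ℓ₁ → Fin n₁) (b b' : Fin ℓ₂ → Fin n₂),
            (∀ s, a s ∈ I₁) → (∀ s, a' s ∈ I₁) →
            (∀ s, b s ∈ I₂) → (∀ s, b' s ∈ I₂) →
            (∀ s u, cmp (a s) (a u) = cmp (a' s) (a' u)) →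
            (∀ s u, cmp (b s) (b u) = cmp (b' s) (b' u)) →
            c a b = c a' b' := by
  classical
  have : NeZero k := ⟨hk.ne'⟩
  obtain ⟨n₁, hn₁, h₁⟩ :=
    exists_ramsey_orderType ((Fin ℓ₂ → Fin ℓ₂ → Ordering) → Fin k) ℓ₁ m₁
  obtain ⟨n₂, hn₂, h₂⟩ := exists_ramsey_orderType ((Fin ℓ₁ → Fin n₁) → Fin k) ℓ₂ m₂
  refine ⟨n₁, n₂, hn₁, hn₂, fun c => ?_⟩
  obtain ⟨I₂, hI₂, hc₂⟩ := h₂ fun b a => c a b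
  obtain ⟨I₁, hI₁, hc₁⟩ := h₁ fun a τ =>
    if h : ∃ b : Fin ℓ₂ → Fin n₂, (∀ s, b s ∈ I₂) ∧ ∀ s u, cmp (b s) (b u) = τ s u
    then c a h.choose else 0
  refine ⟨I₁, I₂, hI₁, hI₂, fun a a' b b' ha ha' hb hb' hcmp hcmp' => ?_⟩
  have hex : ∃ d : Fin ℓ₂ → Fin n₂, (∀ s, d s ∈ I₂) ∧
      ∀ s u, cmp (d s) (d u) = cmp (b s) (b u) := ⟨b, hb, fun _ _ => rfl⟩
  have h := congrFun (hc₁ a a' ha ha' hcmp) fun s u => cmp (b s) (b u)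
  simp only [dif_pos hex] at h
  have hd := hex.choose_spec
  have hbd := hc₂ b hex.choose hb hd.1 fun s u => (hd.2 s u).symm
  have hbb' := hc₂ b b' hb hb' hcmp'
  calc c a b = c a hex.choose := congrFun hbd a
    _ = c a' hex.choose := h
    _ = c a' b := (congrFun hbd a').symm
    _ = c a' b' := congrFun hbb' a'
end

section
/- Let L be a first-order language, M an L-structure, and let I and J be linear orders each with at least 4 elements. Let μ and μ' be (I,J)-meshes in M such that the pair (μ,μ') is regular. Then either μ = μ' or the ranges V(μ) and V(μ') are disjoint. -/
open FirstOrder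

/-- Pairs `(u,v)` and `(u',v')` of elements of the `L`-structure `M` have the same
atomic type if every atomic `L`-formula in two free variables holds of `(u,v)`
iff it holds of `(u',v')`. -/
def AtpEqFO (L : Language) {M : Type*} [L.Structure M] (u v u' v' : M) : Prop :=
  ∀ φ : L.Formula (Fin 2), φ.IsAtomic →
    (φ.Realize ![u, v] ↔ φ.Realize ![u', v'])

/-- A pair `(μ, μ')` of `(I,J)`-meshes is regular if the atomic type of
`(μ(i,j), μ'(i',j'))` depends only on the order types of `(i,i')` and `(j,j')`. -/
def IsRegularPairFO (L : Language) {M : Type*} [L.Structure M]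
    {I J : Type*} [LinearOrder I] [LinearOrder J] (μ μ' : I × J → M) : Prop :=
  ∀ (i₁ i₁' i₂ i₂' : I) (j₁ j₁' j₂ j₂' : J),
    cmp i₁ i₁' = cmp i₂ i₂' → cmp j₁ j₁' = cmp j₂ j₂' →
    AtpEqFO L (μ (i₁, j₁)) (μ' (i₁', j₁')) (μ (i₂, j₂)) (μ' (i₂', j₂'))

/-- Equality between the entries of a regular pair of meshes depends only on the order types. -/
lemma IsRegularPairFO.eq_iff {L : Language} {M : Type*} [L.Structure M]
    {I J : Type*} [LinearOrder I] [LinearOrder J] {μ μ' : I × J → M}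
    (hreg : IsRegularPairFO L μ μ') {i₁ i₁' i₂ i₂' : I} {j₁ j₁' j₂ j₂' : J}
    (hi : cmp i₁ i₁' = cmp i₂ i₂') (hj : cmp j₁ j₁' = cmp j₂ j₂') :
    μ (i₁, j₁) = μ' (i₁', j₁') ↔ μ (i₂, j₂) = μ' (i₂', j₂') := by
  have h := hreg i₁ i₁' i₂ i₂' j₁ j₁' j₂ j₂' hi hj
    ((Language.var (L := L) (Sum.inl (0 : Fin 2) : Fin 2 ⊕ Fin 0)).bdEqual
      (Language.var (Sum.inl 1)))
    (Language.BoundedFormula.IsAtomic.equal _ _)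
  simpa [Language.Formula.Realize] using h

/-- In a linear order with at least three elements, any strict order type with respect to a
suitable element is realized by two distinct elements. -/
lemma exists_ne_cmp_eq {I : Type*} [LinearOrder I] {n : ℕ} (hn : 3 ≤ n)
    (hI : ∃ f : Fin n → I, Function.Injective f) {o : Ordering} (ho : o ≠ .eq) :
    ∃ x y z : I, x ≠ y ∧ cmp x z = o ∧ cmp y z = o := by
  classical
  obtain ⟨f, hf⟩ := hI
  have hcard : (Finset.univ.image f).card = n := by
    rw [Finset.card_image_of_injective _ hf, Finset.card_fin]
  let g := (Finset.univ.image f).orderEmbOfFin hcard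
  have hab : g ⟨0, by omega⟩ < g ⟨1, by omega⟩ := g.strictMono (by simp)
  have hbc : g ⟨1, by omega⟩ < g ⟨2, by omega⟩ := g.strictMono (by simp)
  cases o with
  | lt => exact ⟨_, _, _, hab.ne, (hab.trans hbc).cmp_eq_lt, hbc.cmp_eq_lt⟩
  | eq => exact absurd rfl ho
  | gt => exact ⟨_, _, _, hbc.ne, hab.cmp_eq_gt, (hab.trans hbc).cmp_eq_gt⟩

theorem stmt3 {L : Language} {M : Type*} [L.Structure M]
    {I J : Type*} [LinearOrder I] [LinearOrder J]
    (hI : ∃ f : Fin 4 → I, Function.Injective f)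
    (hJ : ∃ f : Fin 4 → J, Function.Injective f)
    (μ μ' : I × J → M) (hμ : Function.Injective μ) (hμ' : Function.Injective μ')
    (hreg : IsRegularPairFO L μ μ') :
    μ = μ' ∨ Disjoint (Set.range μ) (Set.range μ') := by
  rw [or_iff_not_imp_right, Set.not_disjoint_iff]
  rintro ⟨_, ⟨⟨i, j⟩, rfl⟩, ⟨⟨i', j'⟩, h⟩⟩
  have hi : cmp i i' = .eq := by
    by_contra hne
    obtain ⟨x, y, z, hxy, hx, hy⟩ := exists_ne_cmp_eq (by norm_num) hI hne
    have hxz := (hreg.eq_iff hx.symm (rfl : cmp j j' = _)).1 h.symm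
    have hyz := (hreg.eq_iff hy.symm (rfl : cmp j j' = _)).1 h.symm
    exact hxy (congrArg Prod.fst (hμ (hxz.trans hyz.symm)))
  have hj : cmp j j' = .eq := by
    by_contra hne
    obtain ⟨x, y, z, hxy, hx, hy⟩ := exists_ne_cmp_eq (by norm_num) hJ hne
    have hxz := (hreg.eq_iff (rfl : cmp i i' = _) hx.symm).1 h.symm
    have hyz := (hreg.eq_iff (rfl : cmp i i' = _) hy.symm).1 h.symm
    exact hxy (congrArg Prod.snd (hμ (hxz.trans hyz.symm)))
  ext ⟨a, b⟩
  exact (hreg.eq_iff (hi.trans (cmp_self_eq_eq a).symm) (hj.trans (cmp_self_eq_eq b).symm)).1 h.symm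
end

section
/- Let L be a first-order language, M an L-structure, and I, J finite linear orders with |I|, |J| ≥ 3. Let (μ,μ') be a regular pair of (I,J)-meshes in M such that the mesh μ is regular. Then either μ is pseudo-vertical, or μ is pseudo-horizontal, or the pair (μ,μ') is quasi-homogeneous. -/
open FirstOrder

/-- A pair `(μ, μ')` of `(I,J)`-meshes is homogeneous if the atomic type of
`(μ(i,j), μ'(i',j'))` is the same for all `i, i', j, j'`. -/
def IsHomogeneousPairFO (L : Language) {M : Type*} [L.Structure M]
    {I J : Type*} [LinearOrder I] [LinearOrder J] (μ μ' : I × J → M) : Prop :=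
  ∀ (i₁ i₁' i₂ i₂' : I) (j₁ j₁' j₂ j₂' : J),
    AtpEqFO L (μ (i₁, j₁)) (μ' (i₁', j₁')) (μ (i₂, j₂)) (μ' (i₂', j₂'))

/-- A pair `(μ, μ')` of `(I,J)`-meshes is quasi-homogeneous if it is regular and the atomic
type of `(μ(i,j), μ'(i',j'))` is the same for all `(i,j) ≠ (i',j')`. -/
def IsQuasiHomogeneousPairFO (L : Language) {M : Type*} [L.Structure M]
    {I J : Type*} [LinearOrder I] [LinearOrder J] (μ μ' : I × J → M) : Prop :=
  IsRegularPairFO L μ μ' ∧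
  ∀ (i₁ i₁' i₂ i₂' : I) (j₁ j₁' j₂ j₂' : J),
    (i₁, j₁) ≠ (i₁', j₁') → (i₂, j₂) ≠ (i₂', j₂') →
    AtpEqFO L (μ (i₁, j₁)) (μ' (i₁', j₁')) (μ (i₂, j₂)) (μ' (i₂', j₂'))

/-- An `(I,J)`-mesh is vertical if there is a function `a : I → M` (a vertical guard)
such that `atp(μ(i,j), a(i'))` depends only on `otp(i,i')` and is not the same for all
`i, i' ∈ I` and `j ∈ J`. -/
def IsVerticalFO (L : Language) {M : Type*} [L.Structure M]
    {I J : Type*} [LinearOrder I] [LinearOrder J] (μ : I × J → M) : Prop :=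
  ∃ a : I → M,
    (∀ (i i' i₂ i₂' : I) (j j₂ : J), cmp i i' = cmp i₂ i₂' →
      AtpEqFO L (μ (i, j)) (a i') (μ (i₂, j₂)) (a i₂')) ∧
    ¬ ∀ (i i' i₂ i₂' : I) (j j₂ : J),
      AtpEqFO L (μ (i, j)) (a i') (μ (i₂, j₂)) (a i₂')

/-- An `(I,J)`-mesh is horizontal if there is a function `b : J → M` (a horizontal guard)
such that `atp(μ(i,j), b(j'))` depends only on `otp(j,j')` and is not the same for all
`j, j' ∈ J` and `i ∈ I`. -/
def IsHorizontalFO (L : Language) {M : Type*} [L.Structure M]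
    {I J : Type*} [LinearOrder I] [LinearOrder J] (μ : I × J → M) : Prop :=
  ∃ b : J → M,
    (∀ (j j' j₂ j₂' : J) (i i₂ : I), cmp j j' = cmp j₂ j₂' →
      AtpEqFO L (μ (i, j)) (b j') (μ (i₂, j₂)) (b j₂')) ∧
    ¬ ∀ (j j' j₂ j₂' : J) (i i₂ : I),
      AtpEqFO L (μ (i, j)) (b j') (μ (i₂, j₂)) (b j₂')

/-- The set of elements of a finite nonempty linear order distinct from the minimum
and the maximum. -/
def innerSet (J : Type*) [LinearOrder J] [Fintype J] [Nonempty J] : Set J :=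
  {j | j ≠ Finset.univ.min' Finset.univ_nonempty ∧
       j ≠ Finset.univ.max' Finset.univ_nonempty}

/-- A mesh is pseudo-vertical if it is regular and its restriction to
`I × (J \ {min J, max J})` is vertical. -/
def IsPseudoVerticalFO (L : Language) {M : Type*} [L.Structure M]
    {I J : Type*} [LinearOrder I] [LinearOrder J] [Fintype J] [Nonempty J]
    (μ : I × J → M) : Prop :=
  IsRegularPairFO L μ μ ∧
  IsVerticalFO L (fun p : I × ↥(innerSet J) => μ (p.1, ↑p.2))

/-- A mesh is pseudo-horizontal if it is regular and its restriction to
`(I \ {min I, max I}) × J` is horizontal. -/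
def IsPseudoHorizontalFO (L : Language) {M : Type*} [L.Structure M]
    {I J : Type*} [LinearOrder I] [LinearOrder J] [Fintype I] [Nonempty I]
    (μ : I × J → M) : Prop :=
  IsRegularPairFO L μ μ ∧
  IsHorizontalFO L (fun p : ↥(innerSet I) × J => μ (↑p.1, p.2))

theorem AtpEqFO.symm {L : Language} {M : Type*} [L.Structure M] {u v u' v' : M}
    (h : AtpEqFO L u v u' v') : AtpEqFO L u' v' u v :=
  fun φ hφ => (h φ hφ).symm

theorem AtpEqFO.trans {L : Language} {M : Type*} [L.Structure M] {u v u' v' u'' v'' : M}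
    (h : AtpEqFO L u v u' v') (h' : AtpEqFO L u' v' u'' v'') : AtpEqFO L u v u'' v'' :=
  fun φ hφ => (h φ hφ).trans (h' φ hφ)

theorem IsRegularPairFO.comp_swap {L : Language} {M : Type*} [L.Structure M]
    {I J : Type*} [LinearOrder I] [LinearOrder J] {μ μ' : I × J → M}
    (h : IsRegularPairFO L μ μ') :
    IsRegularPairFO L (fun p : J × I => μ p.swap) (fun p : J × I => μ' p.swap) :=
  fun _ _ _ _ _ _ _ _ hj hi => h _ _ _ _ _ _ _ _ hi hj

theorem IsPseudoVerticalFO.of_swap {L : Language} {M : Type*} [L.Structure M]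
    {I J : Type*} [LinearOrder I] [LinearOrder J] [Fintype I] [Nonempty I] {μ : I × J → M}
    (h : IsPseudoVerticalFO L (fun p : J × I => μ p.swap)) : IsPseudoHorizontalFO L μ :=
  ⟨h.1.comp_swap, h.2⟩

theorem innerSet_nonempty {J : Type*} [LinearOrder J] [Fintype J] [Nonempty J]
    (hJ : 3 ≤ Fintype.card J) : (innerSet J).Nonempty := by
  obtain ⟨j, -, hj⟩ := Finset.exists_mem_notMem_of_card_lt_card
    (s := {Finset.univ.min' Finset.univ_nonempty, Finset.univ.max' Finset.univ_nonempty})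
    (t := (Finset.univ : Finset J))
    (lt_of_le_of_lt Finset.card_le_two (by rwa [Finset.card_univ]))
  exact ⟨j, by simpa [innerSet] using hj⟩

/-- If all inner elements of `J` compare in the same way with `c`, then `i ↦ μ' (i, c)` is a
candidate vertical guard. So if `μ` is not pseudo-vertical, the atomic type of
`(μ(i,j), μ'(i',j'))` does not depend on `i, i'` when `otp(j,j') = otp(j₀,c)`. -/
theorem IsRegularPairFO.atpEqFO_of_not_isPseudoVerticalFO
    {L : Language} {M : Type*} [L.Structure M]
    {I J : Type*} [LinearOrder I] [LinearOrder J] [Fintype J] [Nonempty J]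
    (hJ : 3 ≤ Fintype.card J) {μ μ' : I × J → M}
    (hpair : IsRegularPairFO L μ μ') (hself : IsRegularPairFO L μ μ)
    (hv : ¬ IsPseudoVerticalFO L μ) {c : J} {o : Ordering}
    (hc : ∀ j ∈ innerSet J, cmp j c = o)
    (i₁ i₁' i₂ i₂' : I) {j₁ j₁' j₂ j₂' : J} (h₁ : cmp j₁ j₁' = o) (h₂ : cmp j₂ j₂' = o) :
    AtpEqFO L (μ (i₁, j₁)) (μ' (i₁', j₁')) (μ (i₂, j₂)) (μ' (i₂', j₂')) := by
  have hconst : ∀ (i i' i₂ i₂' : I) (j j₂ : innerSet J),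
      AtpEqFO L (μ (i, j)) (μ' (i', c)) (μ (i₂, j₂)) (μ' (i₂', c)) := by
    by_contra hne
    refine hv ⟨hself, fun i => μ' (i, c), fun i i' i₂ i₂' j j₂ hi => ?_, hne⟩
    exact hpair _ _ _ _ _ _ _ _ hi ((hc j j.2).trans (hc j₂ j₂.2).symm)
  obtain ⟨j₀, hj₀⟩ := innerSet_nonempty hJ
  exact ((hpair _ _ i₁ i₁' _ _ j₀ c rfl (h₁.trans (hc j₀ hj₀).symm)).trans
    (hconst _ _ i₂ i₂' ⟨j₀, hj₀⟩ ⟨j₀, hj₀⟩)).trans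
    (hpair _ _ _ _ _ _ _ _ rfl ((hc j₀ hj₀).trans h₂.symm))

theorem IsRegularPairFO.atpEqFO_of_ne_of_not_isPseudoVerticalFO
    {L : Language} {M : Type*} [L.Structure M]
    {I J : Type*} [LinearOrder I] [LinearOrder J] [Fintype J] [Nonempty J]
    (hJ : 3 ≤ Fintype.card J) {μ μ' : I × J → M}
    (hpair : IsRegularPairFO L μ μ') (hself : IsRegularPairFO L μ μ)
    (hv : ¬ IsPseudoVerticalFO L μ)
    (i₁ i₁' i₂ i₂' : I) {j₁ j₁' j₂ j₂' : J}
    (hne : j₁ ≠ j₁') (hcmp : cmp j₁ j₁' = cmp j₂ j₂') :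
    AtpEqFO L (μ (i₁, j₁)) (μ' (i₁', j₁')) (μ (i₂, j₂)) (μ' (i₂', j₂')) := by
  rcases lt_or_gt_of_ne hne with h | h
  · have h := (cmp_eq_lt_iff _ _).2 h
    refine hpair.atpEqFO_of_not_isPseudoVerticalFO hJ hself hv
      (c := Finset.univ.max' Finset.univ_nonempty)
      (fun j hj => ?_) i₁ i₁' i₂ i₂' h (hcmp.symm.trans h)
    exact (cmp_eq_lt_iff _ _).2
      (lt_of_le_of_ne (Finset.le_max' _ _ (Finset.mem_univ j)) hj.2)
  · have h := (cmp_eq_gt_iff _ _).2 h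
    refine hpair.atpEqFO_of_not_isPseudoVerticalFO hJ hself hv
      (c := Finset.univ.min' Finset.univ_nonempty)
      (fun j hj => ?_) i₁ i₁' i₂ i₂' h (hcmp.symm.trans h)
    exact (cmp_eq_gt_iff _ _).2
      (lt_of_le_of_ne (Finset.min'_le _ _ (Finset.mem_univ j)) hj.1.symm)

theorem stmt5 {L : Language} {M : Type*} [L.Structure M]
    {I J : Type*} [LinearOrder I] [LinearOrder J]
    [Fintype I] [Fintype J] [Nonempty I] [Nonempty J]
    (hI : 3 ≤ Fintype.card I) (hJ : 3 ≤ Fintype.card J)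
    (μ μ' : I × J → M) (hμ : Function.Injective μ) (hμ' : Function.Injective μ')
    (hpair : IsRegularPairFO L μ μ') (hself : IsRegularPairFO L μ μ) :
    IsPseudoVerticalFO L μ ∨ IsPseudoHorizontalFO L μ ∨
      IsQuasiHomogeneousPairFO L μ μ' := by
  by_cases hv : IsPseudoVerticalFO L μ
  · exact Or.inl hv
  by_cases hh : IsPseudoHorizontalFO L μ
  · exact Or.inr (Or.inl hh)
  refine Or.inr (Or.inr ⟨hpair, ?_⟩)
  have vert := fun (i₁ i₁' i₂ i₂' : I) {j₁ j₁' j₂ j₂' : J} =>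
    hpair.atpEqFO_of_ne_of_not_isPseudoVerticalFO hJ hself hv i₁ i₁' i₂ i₂'
      (j₁ := j₁) (j₁' := j₁') (j₂ := j₂) (j₂' := j₂')
  have horiz := fun (j₁ j₁' j₂ j₂' : J) {i₁ i₁' i₂ i₂' : I} =>
    hpair.comp_swap.atpEqFO_of_ne_of_not_isPseudoVerticalFO hI hself.comp_swap
      (fun h => hh h.of_swap) j₁ j₁' j₂ j₂'
      (j₁ := i₁) (j₁' := i₁') (j₂ := i₂) (j₂' := i₂')
  have := (Fintype.one_lt_card_iff_nontrivial.1
    (show 1 < Fintype.card I by omega))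
  obtain ⟨m, i₀, hi⟩ := exists_pair_lt I
  have := (Fintype.one_lt_card_iff_nontrivial.1
    (show 1 < Fintype.card J by omega))
  obtain ⟨n, j₀, hj⟩ := exists_pair_lt J
  have off_row : ∀ (i i' : I) (j j' : J), j ≠ j' →
      AtpEqFO L (μ (i, j)) (μ' (i', j')) (μ (i₀, j₀)) (μ' (m, n)) := by
    intro i i' j j' hne
    rcases lt_or_gt_of_ne hne with h | h
    · exact (vert i i' i₀ m (j₂ := n) (j₂' := j₀) hne
        (((cmp_eq_lt_iff _ _).2 h).trans ((cmp_eq_lt_iff _ _).2 hj).symm)).trans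
        (horiz _ _ _ _ hi.ne' rfl)
    · exact vert _ _ _ _ hne
        (((cmp_eq_gt_iff _ _).2 h).trans ((cmp_eq_gt_iff _ _).2 hj).symm)
  have key : ∀ (i i' : I) (j j' : J), (i, j) ≠ (i', j') →
      AtpEqFO L (μ (i, j)) (μ' (i', j')) (μ (i₀, j₀)) (μ' (m, n)) := by
    intro i i' j j' hne
    by_cases hj' : j = j'
    · exact (horiz j j' j₀ n (fun hi' => hne (Prod.ext hi' hj')) rfl).trans
        (off_row i i' _ _ hj.ne')
    · exact off_row _ _ _ _ hj'
  exact fun _ _ _ _ _ _ _ _ h₁ h₂ => (key _ _ _ _ h₁).trans (key _ _ _ _ h₂).symm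
end

section
/- Let ≺ be a tree-order on a type M. Let X and Y be disjoint antichains for ≺, each with at least two elements, such that the comparability pattern across the pair is constant: for all x, x' ∈ X and y, y' ∈ Y, (x ≺ y ↔ x' ≺ y') and (y ≺ x ↔ y' ≺ x'). Then X ∪ Y is an antichain for ≺. -/
/-- A tree-order on `M` is a strict partial order `prec` with a least element (the root)
such that the set of `prec`-predecessors of any element is linearly ordered by `prec`. -/
def IsTreeOrder {M : Type*} (prec : M → M → Prop) : Prop :=
  (∀ x, ¬ prec x x) ∧
  (∀ x y z, prec x y → prec y z → prec x z) ∧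
  (∃ r : M, ∀ x, x ≠ r → prec r x) ∧
  (∀ x y z, prec y x → prec z x → prec y z ∨ y = z ∨ prec z y)

/-- A subset of `M` is an antichain for `prec` if no two distinct elements of it are
comparable. -/
def IsPrecAntichain {M : Type*} (prec : M → M → Prop) (S : Set M) : Prop :=
  ∀ x ∈ S, ∀ y ∈ S, x ≠ y → ¬ prec x y ∧ ¬ prec y x

theorem stmt15 {M : Type*} (prec : M → M → Prop) (htree : IsTreeOrder prec)
    (X Y : Set M) (hdisj : Disjoint X Y)
    (hX : IsPrecAntichain prec X) (hY : IsPrecAntichain prec Y)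
    (hX2 : X.Nontrivial) (hY2 : Y.Nontrivial)
    (hconst : ∀ x ∈ X, ∀ x' ∈ X, ∀ y ∈ Y, ∀ y' ∈ Y,
      (prec x y ↔ prec x' y') ∧ (prec y x ↔ prec y' x')) :
    IsPrecAntichain prec (X ∪ Y) := by
  obtain ⟨-, -, -, hlin⟩ := htree
  obtain ⟨a, ha, b, hb, hab⟩ := hX2
  obtain ⟨c, hc, d, hd, hcd⟩ := hY2
  have hXY : ∀ x ∈ X, ∀ y ∈ Y, ¬ prec x y ∧ ¬ prec y x := by
    intro x hx y hy
    constructor <;> intro h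
    · have := hlin y a b ((hconst x hx a ha y hy y hy).1.1 h)
        ((hconst x hx b hb y hy y hy).1.1 h)
      have := hX a ha b hb hab
      tauto
    · have := hlin x c d ((hconst x hx x hx y hy c hc).2.1 h)
        ((hconst x hx x hx y hy d hd).2.1 h)
      have := hY c hc d hd hcd
      tauto
  rintro x (hx | hx) y (hy | hy) hne
  · exact hX x hx y hy hne
  · exact hXY x hx y hy
  · exact (hXY y hy x hx).symm
  · exact hY x hx y hy hne
end
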